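/- Let F be a CM-field and let U_F be the algebraic torus over ℚ with U_F(R) = {x ∈ (F ⊗_ℚ R)* : x·x̄ = 1} for ℚ-algebras R, where x ↦ x̄ is induced by complex conjugation on F. If H ⊆ U_F is an algebraic subtorus of codimension 1, then there exists an imaginary quadratic subfield k ⊆ F such that H = SU_{F/k} := Ker(Nm_{F/k} : U_F → U_k), where Nm_{F/k} is induced by the field norm from F to k. -/

import Mathlib

open scoped Classical

noncomputable section

/-- The (rational) cocharacter space of the norm-one torus `U_F` of a CM-field `F` with
complex conjugation `ι`: inside the cocharacter space `ℚ^Σ` of `Res_{F/ℚ} 𝔾ₘ` (where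
`Σ` is the set of embeddings `F → ℂ`), it is cut out by the equations
`x σ + x σ̄ = 0`. -/
def normOneCocharSpace (F : Type*) [Field F] [NumberField F] (ι : F ≃ₐ[ℚ] F) :
    Submodule ℚ ((F →ₐ[ℚ] ℂ) → ℚ) where
  carrier := {x | ∀ σ : F →ₐ[ℚ] ℂ, x σ + x (σ.comp ι.toAlgHom) = 0}
  add_mem' := by
    intro a b ha hb σ
    have h1 := ha σ; have h2 := hb σ
    simp only [Pi.add_apply]; linarith
  zero_mem' := by intro σ; simp
  smul_mem' := by
    intro c x hx σ
    simp only [Pi.smul_apply, smul_eq_mul, ← mul_add, hx σ, mul_zero]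

universe u

open Cardinal in
/-- Two uncountable algebraically closed extensions of a countable field, of the same cardinality,
are isomorphic over that field. -/
theorem IsAlgClosed.nonempty_algEquiv_of_countable {K : Type*} {L M : Type u}
    [Field K] [Countable K] [Field L] [Field M] [Algebra K L] [Algebra K M]
    [IsAlgClosed L] [IsAlgClosed M] (hL : ℵ₀ < #L) (hLM : #L = #M) :
    Nonempty (L ≃ₐ[K] M) := by
  obtain ⟨s, hs⟩ := exists_isTranscendenceBasis K L
  obtain ⟨t, ht⟩ := exists_isTranscendenceBasis K M
  have hcard : #s = #t := by
    have h₁ := cardinal_eq_cardinal_transcendence_basis_of_aleph0_lt _ hs mk_le_aleph0 hL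
    have h₂ := cardinal_eq_cardinal_transcendence_basis_of_aleph0_lt _ ht mk_le_aleph0 (hLM ▸ hL)
    simp only [lift_id] at h₁ h₂
    rw [← h₁, ← h₂, hLM]
  obtain ⟨e⟩ := Cardinal.eq.1 hcard
  let x : s → L := (↑)
  let y : t → M := (↑)
  have := isAlgClosure_of_transcendence_basis x hs
  have := isAlgClosure_of_transcendence_basis y ht
  let f : Algebra.adjoin K (Set.range x) ≃ₐ[K] Algebra.adjoin K (Set.range y) :=
    (hs.1.aevalEquiv.symm.trans (MvPolynomial.renameEquiv K e)).trans ht.1.aevalEquiv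
  exact ⟨AlgEquiv.ofRingEquiv (f := IsAlgClosure.equivOfEquiv L M f.toRingEquiv) fun c => by
    have h := IsAlgClosure.equivOfEquiv_algebraMap L M f.toRingEquiv (algebraMap K _ c)
    have hf : f.toRingEquiv (algebraMap K _ c) = algebraMap K _ c := f.commutes c
    rwa [hf] at h⟩

open Cardinal in
/-- Any two complex embeddings of a number field differ by a field automorphism of `ℂ`. -/
theorem Complex.exists_algEquiv_comp_eq {K : Type*} [Field K] [NumberField K]
    (σ τ : K →ₐ[ℚ] ℂ) : ∃ g : ℂ ≃ₐ[ℚ] ℂ, (g : ℂ →ₐ[ℚ] ℂ).comp σ = τ := by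
  have : Countable K := by
    have := Algebra.IsAlgebraic.lift_cardinalMk_le_max ℚ K
    simpa [Cardinal.mk_le_aleph0_iff] using this
  have hC : ℵ₀ < #ℂ := by simp [Cardinal.aleph0_lt_continuum]
  obtain ⟨e⟩ := @IsAlgClosed.nonempty_algEquiv_of_countable K ℂ ℂ _ _ _ _
    σ.toRingHom.toAlgebra τ.toRingHom.toAlgebra _ _ hC rfl
  let g : ℂ ≃+* ℂ := @AlgEquiv.toRingEquiv K ℂ ℂ _ _ _
    σ.toRingHom.toAlgebra τ.toRingHom.toAlgebra e
  refine ⟨AlgEquiv.ofRingEquiv (f := g) (fun q => by simp), AlgHom.ext fun x => ?_⟩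
  exact @AlgEquiv.commutes K ℂ ℂ _ _ _ σ.toRingHom.toAlgebra τ.toRingHom.toAlgebra e x

/-- An algebraic number fixed by all automorphisms of `ℂ` that fix `σ K` lies in `σ K`. -/
theorem Complex.mem_range_of_forall_algEquiv_fixed {K : Type*} [Field K] [NumberField K]
    (σ : K →ₐ[ℚ] ℂ) {δ : ℂ} (hδ : IsAlgebraic ℚ δ)
    (h : ∀ g : ℂ ≃ₐ[ℚ] ℂ, (g : ℂ →ₐ[ℚ] ℂ).comp σ = σ → g δ = δ) : δ ∈ σ.range := by
  let : Algebra K ℂ := σ.toRingHom.toAlgebra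
  have : IsScalarTower ℚ K ℂ := IsScalarTower.of_algebraMap_eq fun q => (σ.commutes q).symm
  have hint : IsIntegral K δ := hδ.isIntegral.tower_top
  let M := IntermediateField.adjoin K {δ}
  have : FiniteDimensional K M := IntermediateField.adjoin.finiteDimensional hint
  have : FiniteDimensional ℚ M := FiniteDimensional.trans ℚ K M
  have : NumberField M := { to_finiteDimensional := this, to_charZero := inferInstance}
  have hcard : Fintype.card (M →ₐ[K] ℂ) = 1 := by
    rw [Fintype.card_eq_one_iff]
    refine ⟨M.val, fun τ => ?_⟩
    obtain ⟨g, hg⟩ := Complex.exists_algEquiv_comp_eq (M.val.restrictScalars ℚ)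
      (τ.restrictScalars ℚ)
    have hg' (m : M) : g m = τ m := congr($hg m)
    have hfix : g δ = δ := h g <| AlgHom.ext fun x =>
      (hg' (algebraMap K M x)).trans (τ.commutes x)
    apply IntermediateField.algHom_ext_of_eq_adjoin K (S := M) (s := {δ}) rfl
    rintro x hx
    obtain rfl : x = δ := hx
    rw [← hg']
    exact hfix
  rw [AlgHom.card] at hcard
  have := IntermediateField.finrank_eq_one_iff.1 hcard
  have hmem : δ ∈ M := IntermediateField.mem_adjoin_simple_self K δ
  rw [this, IntermediateField.mem_bot] at hmem
  exact hmem

/-- A codimension-one subspace `W` of `V ≤ ℚⁿ` is the orthogonal complement in `V` of a nonzero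
vector of `V`. -/
theorem Submodule.exists_dotProduct_eq_zero_iff {n : Type*} [Fintype n]
    {W V : Submodule ℚ (n → ℚ)} (hWV : W ≤ V)
    (hcodim : Module.finrank ℚ W + 1 = Module.finrank ℚ V) :
    ∃ y ∈ V, y ≠ 0 ∧ ∀ x, x ∈ W ↔ x ∈ V ∧ x ⬝ᵥ y = 0 := by
  let B : LinearMap.BilinForm ℚ (n → ℚ) := dotProductBilin ℚ ℚ
  have hBapp (u v : n → ℚ) : B u v = u ⬝ᵥ v := rfl
  have hB : B.IsRefl := fun u v h => by rw [hBapp, dotProduct_comm]; exact h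
  have hBW : (B.restrict W).Nondegenerate := by
    refine ⟨?_, ?_⟩ <;>
    · intro w hw
      have := hw w
      exact Subtype.ext (dotProduct_self_eq_zero.1 this)
  have hcompl := (LinearMap.BilinForm.restrict_nondegenerate_iff_isCompl_orthogonal hB).1 hBW
  have hlt : W < V := lt_of_le_of_ne hWV (by rintro rfl; omega)
  obtain ⟨x₁, hx₁V, hx₁W⟩ := SetLike.exists_of_lt hlt
  obtain ⟨w, hw, y, hy, rfl⟩ := Submodule.mem_sup.1
    (hcompl.sup_eq_top.symm ▸ Submodule.mem_top : x₁ ∈ W ⊔ B.orthogonal W)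
  have hyV : y ∈ V := (V.add_mem_iff_right (hWV hw)).1 hx₁V
  have hyW : y ∉ W := fun h => hx₁W (W.add_mem hw h)
  have hy0 : y ≠ 0 := fun h => hyW (h ▸ W.zero_mem)
  have horth (w) (hw : w ∈ W) : w ⬝ᵥ y = 0 := hy w hw
  refine ⟨y, hyV, hy0, fun x => ⟨fun hx => ⟨hWV hx, horth x hx⟩, fun ⟨hxV, hxy⟩ => ?_⟩⟩
  have hspan : W ⊔ span ℚ {y} = V := by
    apply eq_of_le_of_finrank_le (sup_le hWV (by simpa using hyV))
    rw [← hcodim]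
    apply Submodule.finrank_lt_finrank_of_lt
    refine lt_of_le_of_ne le_sup_left fun h => hyW ?_
    rw [h]
    exact mem_sup_right (mem_span_singleton_self y)
  rw [← hspan] at hxV
  obtain ⟨w', hw', z, hz, rfl⟩ := Submodule.mem_sup.1 hxV
  obtain ⟨c, rfl⟩ := mem_span_singleton.1 hz
  rw [add_dotProduct, horth w' hw', smul_dotProduct, zero_add, smul_eq_mul, mul_eq_zero,
    dotProduct_self_eq_zero] at hxy
  simpa [hxy.resolve_right hy0] using hw'

/-- A coordinate permutation preserving a hyperplane `W` of `V ≤ ℚⁿ` maps a normal vector of `W` to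
plus or minus itself. -/
theorem Submodule.comp_perm_eq_or_eq_neg {n : Type*} [Fintype n]
    {W V : Submodule ℚ (n → ℚ)} {y : n → ℚ} (hyV : y ∈ V)
    (hW : ∀ x, x ∈ W ↔ x ∈ V ∧ x ⬝ᵥ y = 0) (e : Equiv.Perm n)
    (hV : y ∘ e ∈ V) (heW : ∀ x ∈ W, x ∘ e.symm ∈ W) :
    y ∘ e = y ∨ y ∘ e = -y := by
  rcases eq_or_ne y 0 with rfl | hy0
  · left; rfl
  have hyy : y ⬝ᵥ y ≠ 0 := fun h => hy0 (dotProduct_self_eq_zero.1 h)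
  have horth (x) (hx : x ∈ W) : x ⬝ᵥ (y ∘ e) = 0 := by
    rw [← comp_equiv_symm_dotProduct]
    exact ((hW _).1 (heW x hx)).2
  set c : ℚ := (y ∘ e) ⬝ᵥ y / (y ⬝ᵥ y) with hc
  have hz : y ∘ e - c • y ∈ W := by
    refine (hW _).2 ⟨V.sub_mem hV (V.smul_mem c hyV), ?_⟩
    rw [sub_dotProduct, smul_dotProduct, hc, smul_eq_mul, div_mul_cancel₀ _ hyy, sub_self]
  have hz0 : y ∘ e - c • y = 0 := by
    rw [← dotProduct_self_eq_zero, dotProduct_sub, dotProduct_smul, horth _ hz,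
      ((hW _).1 hz).2, smul_zero, sub_zero]
  rw [sub_eq_zero] at hz0
  have hsq : c * c = 1 := by
    have h : (y ∘ e) ⬝ᵥ (y ∘ e) = y ⬝ᵥ y := by
      rw [← comp_equiv_symm_dotProduct, Function.comp_assoc, Equiv.self_comp_symm,
        Function.comp_id]
    rw [hz0, smul_dotProduct, dotProduct_smul, smul_eq_mul, smul_eq_mul, ← mul_assoc] at h
    exact mul_right_cancel₀ hyy (by rw [h, one_mul])
  rcases mul_self_eq_one_iff.1 hsq with h | h <;> rw [h] at hz0
  · left; simpa using hz0
  · right; simpa using hz0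

/-- The permutation of the complex embeddings of `F` given by postcomposition with `g`. -/
def embeddingPerm (F : Type*) [Field F] [Algebra ℚ F] (g : ℂ ≃ₐ[ℚ] ℂ) :
    Equiv.Perm (F →ₐ[ℚ] ℂ) where
  toFun σ := (g : ℂ →ₐ[ℚ] ℂ).comp σ
  invFun σ := (g.symm : ℂ →ₐ[ℚ] ℂ).comp σ
  left_inv σ := AlgHom.ext fun x => g.symm_apply_apply (σ x)
  right_inv σ := AlgHom.ext fun x => g.apply_symm_apply (σ x)

/-- The elements of `F` whose image under a complex embedding `σ` depends only on `y σ`. -/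
def levelField {F : Type*} [Field F] [Algebra ℚ F] (y : (F →ₐ[ℚ] ℂ) → ℚ) :
    IntermediateField ℚ F where
  carrier := {a | ∀ σ τ : F →ₐ[ℚ] ℂ, y σ = y τ → σ a = τ a}
  mul_mem' ha hb σ τ h := by rw [map_mul, map_mul, ha σ τ h, hb σ τ h]
  add_mem' ha hb σ τ h := by rw [map_add, map_add, ha σ τ h, hb σ τ h]
  algebraMap_mem' q σ τ _ := by rw [σ.commutes, τ.commutes]
  inv_mem' a ha σ τ h := by rw [map_inv₀, map_inv₀, ha σ τ h]

/-- A function on the complex embeddings of `F` on which every automorphism of `ℂ` acts by a sign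
is, up to a scalar, of the form `σ ↦ σ a`. -/
theorem exists_apply_eq_mul {F : Type*} [Field F] [NumberField F] {y : (F →ₐ[ℚ] ℂ) → ℚ}
    (hy : ∀ σ, y σ ≠ 0)
    (hsign : ∀ g, y ∘ embeddingPerm F g = y ∨ y ∘ embeddingPerm F g = -y) :
    ∃ (a : F) (c : ℂ), c ≠ 0 ∧ ∀ σ : F →ₐ[ℚ] ℂ, σ a = y σ * c := by
  obtain ⟨σ₀⟩ : Nonempty (F →ₐ[ℚ] ℂ) := ⟨IsAlgClosed.lift⟩
  obtain ⟨b, hb⟩ : ∃ b : F, ∑ σ : F →ₐ[ℚ] ℂ, (y σ : ℂ) * σ b ≠ 0 := by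
    by_contra! h
    have hli := Fintype.linearIndependent_iff.1 (linearIndependent_toLinearMap ℚ F ℂ)
      (fun σ => (y σ : ℂ)) (LinearMap.ext fun b => by simpa using h b) σ₀
    exact hy σ₀ (by exact_mod_cast hli)
  set δ := ∑ σ : F →ₐ[ℚ] ℂ, (y σ : ℂ) * σ b with hδ
  have hδalg : IsAlgebraic ℚ δ := by
    refine IsIntegral.isAlgebraic (IsIntegral.sum _ fun σ _ => IsIntegral.mul ?_ ?_)
    · exact isIntegral_algebraMap (x := y σ)
    · exact (Algebra.IsIntegral.isIntegral (R := ℚ) b).map σ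
  have hg (g : ℂ ≃ₐ[ℚ] ℂ) : g δ = ∑ σ : F →ₐ[ℚ] ℂ, (y σ : ℂ) * embeddingPerm F g σ b := by
    rw [hδ, map_sum]
    refine Finset.sum_congr rfl fun σ _ => ?_
    rw [map_mul, map_ratCast]
    rfl
  have hgδ (g : ℂ ≃ₐ[ℚ] ℂ) (σ : F →ₐ[ℚ] ℂ) :
      (y σ : ℂ) * g δ = y (embeddingPerm F g σ) * δ := by
    have hsum := Equiv.sum_comp (embeddingPerm F g) fun σ => (y σ : ℂ) * σ b
    rcases hsign g with h | h
    · have h' (σ) : y (embeddingPerm F g σ) = y σ := congrFun h σ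
      simp only [h'] at hsum
      rw [hg, hsum, h']
    · have h' (σ) : y (embeddingPerm F g σ) = -y σ := congrFun h σ
      simp only [h', Rat.cast_neg, neg_mul, Finset.sum_neg_distrib] at hsum
      rw [hg, h', hδ, ← hsum]
      simp
  obtain ⟨a, ha⟩ := Complex.mem_range_of_forall_algEquiv_fixed σ₀ hδalg fun g hgσ => by
    have h := hgδ g σ₀
    rw [show embeddingPerm F g σ₀ = σ₀ from hgσ] at h
    exact mul_left_cancel₀ (by exact_mod_cast hy σ₀) h
  replace ha : σ₀ a = δ := ha
  have hy₀ : (y σ₀ : ℂ) ≠ 0 := by exact_mod_cast hy σ₀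
  refine ⟨a, δ / y σ₀, div_ne_zero hb hy₀, fun σ => ?_⟩
  obtain ⟨g, rfl⟩ := Complex.exists_algEquiv_comp_eq σ₀ σ
  have h := hgδ g σ₀
  rw [← mul_div_assoc, eq_div_iff hy₀, mul_comm]
  simpa [← ha, embeddingPerm] using h

/-- Every codimension-1 subtorus `H` of the norm-one torus `U_F` of a CM-field `F` is
of the form `SU_{F/k} = Ker(Nm_{F/k} : U_F → U_k)` for an imaginary quadratic subfield
`k ⊆ F`.  (Formulated dually, via the antiequivalence between tori over `ℚ` and Galois
lattices: every Galois-stable hyperplane `W` of the rational cocharacter space of `U_F`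
is the set of cocharacters killed by the norm map to some imaginary quadratic `k ⊆ F`,
i.e. those `x` with `∑_{σ|_k = τ} x σ = 0` for every embedding `τ : k → ℂ`.) -/
theorem codim_one_subtorus_of_normOne_torus_eq_SU
    (F : Type*) [Field F] [NumberField F]
    (F₀ : IntermediateField ℚ F)
    (htotallyReal : ∀ σ : F₀ →+* ℂ, ∀ x : F₀, (σ x).im = 0)
    (hquadratic : Module.finrank F₀ F = 2)
    (htotallyImaginary : ∀ σ : F →+* ℂ, ∃ x : F, (σ x).im ≠ 0)
    (ι : F ≃ₐ[ℚ] F) (hι : ι ≠ AlgEquiv.refl)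
    (hconj : ∀ (σ : F →+* ℂ) (x : F), σ (ι x) = starRingEnd ℂ (σ x))
    (W : Submodule ℚ ((F →ₐ[ℚ] ℂ) → ℚ))
    (hWle : W ≤ normOneCocharSpace F ι)
    (hWcodim : Module.finrank ℚ W + 1 = Module.finrank ℚ (normOneCocharSpace F ι))
    (hWstable : ∀ g : ℂ ≃ₐ[ℚ] ℂ, ∀ x ∈ W,
      (fun σ : F →ₐ[ℚ] ℂ => x ((g.symm.toAlgHom : ℂ →ₐ[ℚ] ℂ).comp σ)) ∈ W) :
    ∃ k : IntermediateField ℚ F, Module.finrank ℚ k = 2 ∧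
      (∀ ψ : k →+* ℂ, ∃ a : k, (ψ a).im ≠ 0) ∧
      ∀ x : (F →ₐ[ℚ] ℂ) → ℚ,
        x ∈ W ↔ x ∈ normOneCocharSpace F ι ∧
          ∀ τ : k →ₐ[ℚ] ℂ,
            ∑ σ ∈ Finset.univ.filter (fun σ : F →ₐ[ℚ] ℂ => σ.comp k.val = τ), x σ = 0 := by
  have hιι (x : F) : ι (ι x) = x := by
    obtain ⟨σ⟩ : Nonempty (F →ₐ[ℚ] ℂ) := ⟨IsAlgClosed.lift⟩
    apply σ.toRingHom.injective
    rw [hconj, hconj, Complex.conj_conj]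
  let c : Equiv.Perm (F →ₐ[ℚ] ℂ) :=
    Function.Involutive.toPerm (fun σ => σ.comp ι.toAlgHom)
      fun σ => AlgHom.ext fun x => congrArg σ (hιι x)
  have hmem (x : (F →ₐ[ℚ] ℂ) → ℚ) : x ∈ normOneCocharSpace F ι ↔ ∀ σ, x (c σ) = -x σ :=
    forall_congr' fun σ => add_eq_zero_iff_neg_eq.trans eq_comm
  obtain ⟨y, hyV, hy0, hW⟩ := Submodule.exists_dotProduct_eq_zero_iff hWle hWcodim
  have hsign (g : ℂ ≃ₐ[ℚ] ℂ) : y ∘ embeddingPerm F g = y ∨ y ∘ embeddingPerm F g = -y :=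
    Submodule.comp_perm_eq_or_eq_neg hyV hW _
      ((hmem _).2 fun σ => (hmem y).1 hyV (embeddingPerm F g σ)) fun x hx => hWstable g x hx
  have hpm (σ τ : F →ₐ[ℚ] ℂ) : y τ = y σ ∨ y τ = -y σ := by
    obtain ⟨g, rfl⟩ := Complex.exists_algEquiv_comp_eq σ τ
    exact (hsign g).imp (congrFun · σ) (congrFun · σ)
  have hy (σ) : y σ ≠ 0 := fun h => hy0 <| funext fun τ => by
    simpa [h] using hpm σ τ
  obtain ⟨a, δ, hδ, ha⟩ := exists_apply_eq_mul hy hsign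
  let k := levelField y
  have hak : a ∈ k := fun σ τ h => by rw [ha, ha, h]
  have hres (σ τ : F →ₐ[ℚ] ℂ) : σ.comp k.val = τ.comp k.val ↔ y σ = y τ := by
    refine ⟨fun h => ?_, fun h => AlgHom.ext fun x => x.2 σ τ h⟩
    have h' : σ a = τ a := congr($h ⟨a, hak⟩)
    rw [ha, ha] at h'
    exact_mod_cast mul_right_cancel₀ hδ h'
  have hext (τ : k →ₐ[ℚ] ℂ) : ∃ σ : F →ₐ[ℚ] ℂ, σ.comp k.val = τ :=
    IsAlgClosed.surjective_domRestrict_of_isAlgebraic (E := F) τ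
  obtain ⟨σ₀⟩ : Nonempty (F →ₐ[ℚ] ℂ) := ⟨IsAlgClosed.lift⟩
  have hc (σ) : y (c σ) = -y σ := (hmem y).1 hyV σ
  refine ⟨k, ?_, fun ψ => ⟨⟨a, hak⟩, fun him => ?_⟩, fun x => ?_⟩
  · rw [← AlgHom.card ℚ k ℂ, ← Nat.card_eq_fintype_card, Nat.card_eq_two_iff]
    refine ⟨σ₀.comp k.val, (c σ₀).comp k.val, fun h => ?_, Set.eq_univ_of_forall fun τ => ?_⟩
    · exact hy σ₀ (self_eq_neg.1 (((hres _ _).1 h).trans (hc σ₀)))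
    · obtain ⟨σ, rfl⟩ := hext τ
      exact (hpm σ₀ σ).imp (hres σ σ₀).2 fun h => (hres σ (c σ₀)).2 (h.trans (hc σ₀).symm)
  · obtain ⟨σ, hσ⟩ := hext (ψ.toRatAlgHom)
    have h₁ : σ a = ψ ⟨a, hak⟩ := congr($hσ ⟨a, hak⟩)
    have h₂ : c σ a = starRingEnd ℂ (σ a) := hconj σ a
    rw [Complex.conj_eq_iff_im.2 (h₁ ▸ him), ha, ha, hc] at h₂
    have h₃ := mul_right_cancel₀ hδ h₂
    norm_cast at h₃
    exact hy σ (neg_eq_self.1 h₃)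
  · rw [hW]
    refine and_congr_right fun hx => ?_
    have hfib (σ : F →ₐ[ℚ] ℂ) :
        2 * y σ * ∑ τ with τ.comp k.val = σ.comp k.val, x τ = x ⬝ᵥ y := by
      have hsum : ∑ τ, x τ = 0 := by
        have h := Equiv.sum_comp c x
        simp only [(hmem x).1 hx, Finset.sum_neg_distrib] at h
        linarith
      calc _ = ∑ τ, x τ * y τ + y σ * ∑ τ, x τ := by
            rw [Finset.sum_filter, Finset.mul_sum, Finset.mul_sum, ← Finset.sum_add_distrib]
            refine Finset.sum_congr rfl fun τ _ => ?_
            rw [hres]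
            split_ifs with h
            · rw [h]; ring
            · rw [(hpm σ τ).resolve_left h]; ring
        _ = x ⬝ᵥ y := by rw [hsum, mul_zero, add_zero, dotProduct]
    constructor
    · intro h τ
      obtain ⟨σ, rfl⟩ := hext τ
      have h' := hfib σ
      rw [h] at h'
      exact (mul_eq_zero.1 h').resolve_left (mul_ne_zero two_ne_zero (hy σ))
    · intro h
      rw [← hfib σ₀]
      exact (congrArg _ (h _)).trans (mul_zero _)

end
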